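/- arXiv:1805.05684 — 2 statements merged into one kernel-verified Lean document; each statement's English description precedes it below -/
import Mathlib

section
/- Let T be the bilinear form T = (1/√2)·[ −A·u♭⊗e♭ + ((1/3)Θ + Σ)·e♭⊗e♭ + ((1/3)Θ − (1/2)Σ)·N − A·u♭⊗u♭ + ((1/3)Θ + Σ)·e♭⊗u♭ + (1/2)φ·N + u♭⊗ω₁ + e♭⊗ω₂ + ω₃⊗(u♭ + e♭) + c·ε + ζ + S ], where A, Θ, Σ, φ, c are real numbers, ω₁, ω₂, ω₃ are sheet covectors, ε is an antisymmetric sheet form, and ζ, S are symmetric sheet forms whose N-traces vanish. Then the N-trace N^{cd}T_{dc} (indices raised with η) equals (1/√2)·((2/3)Θ − Σ + φ). In other words, the outgoing null expansion scalar of a 2-surface in a general 4-dimensional spacetime whose null normals lie in the [u,e] plane coincides with its LRS II value and depends only on Θ, Σ and φ. -/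
open Finset

/-- The Minkowski bilinear form on `ℝ⁴`: `η(x,y) = −x₀y₀ + x₁y₁ + x₂y₂ + x₃y₃`. -/
def minkEta (x y : Fin 4 → ℝ) : ℝ :=
  -(x 0 * y 0) + x 1 * y 1 + x 2 * y 2 + x 3 * y 3

/-- The Minkowski metric matrix `η_{ab} = diag(−1,1,1,1)` (equal to its own inverse,
so indices are raised with the same matrix). -/
def minkM : Fin 4 → Fin 4 → ℝ :=
  fun i j => if i = j then (if i = 0 then -1 else 1) else 0

/-- The standard basis vectors of `ℝ⁴`. -/
def basisV (i : Fin 4) : Fin 4 → ℝ := Pi.single i 1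

/-- The `N`-trace `N^{cd} B_{dc}` of a bilinear form `B`, where the matrix
`Nm c' d'` holds the components `N_{c'd'}` and indices are raised with `η`. -/
def Ntrace (Nm : Fin 4 → Fin 4 → ℝ) (B : (Fin 4 → ℝ) → (Fin 4 → ℝ) → ℝ) : ℝ :=
  ∑ c, ∑ d, (∑ c', ∑ d', minkM c c' * minkM d d' * Nm c' d') * B (basisV d) (basisV c)

/-- The sheet projector with raised indices, `N^{cd} = η^{cd} + u^c u^d − e^c e^d`. -/
def sheetProj (u e : Fin 4 → ℝ) (c d : Fin 4) : ℝ :=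
  minkM c d + u c * u d - e c * e d

lemma sheetProj_comm (u e : Fin 4 → ℝ) (c d : Fin 4) :
    sheetProj u e c d = sheetProj u e d c := by
  simp only [sheetProj, minkM]
  by_cases h : c = d
  · subst h; rfl
  · simp only [h, Ne.symm h, if_false]; ring

lemma minkEta_comm (x y : Fin 4 → ℝ) : minkEta x y = minkEta y x := by
  simp only [minkEta]; ring

/-- Contracting `N^{cd}` with a lowered vector `v_d`. -/
lemma sum_sheetProj_mul_minkEta (u e v : Fin 4 → ℝ) (c : Fin 4) :
    ∑ d, sheetProj u e c d * minkEta v (basisV d)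
      = v c + u c * minkEta u v - e c * minkEta e v := by
  fin_cases c <;>
    simp [Fin.sum_univ_four, sheetProj, minkM, minkEta, basisV] <;> ring

lemma Ntrace_eq_sum_sheetProj {u e : Fin 4 → ℝ} {Nf : (Fin 4 → ℝ) → (Fin 4 → ℝ) → ℝ}
    (hNf : ∀ x y, Nf x y = minkEta x y + minkEta u x * minkEta u y - minkEta e x * minkEta e y)
    (B : (Fin 4 → ℝ) → (Fin 4 → ℝ) → ℝ) :
    Ntrace (fun a b => Nf (basisV a) (basisV b)) B
      = ∑ c, ∑ d, sheetProj u e c d * B (basisV d) (basisV c) := by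
  refine Finset.sum_congr rfl fun c _ => Finset.sum_congr rfl fun d _ => ?_
  congr 1
  fin_cases c <;> fin_cases d <;>
    simp [sheetProj, hNf, minkM, minkEta, basisV] <;> ring

lemma sum_sheetProj_flat_mul {u e v : Fin 4 → ℝ}
    (hv : ∀ c, v c + u c * minkEta u v - e c * minkEta e v = 0) (f : (Fin 4 → ℝ) → ℝ) :
    ∑ c, ∑ d, sheetProj u e c d * (minkEta v (basisV d) * f (basisV c)) = 0 := by
  simp only [← mul_assoc, ← Finset.sum_mul, sum_sheetProj_mul_minkEta, hv, zero_mul,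
    Finset.sum_const_zero]

lemma sum_sheetProj_swap (u e : Fin 4 → ℝ) (B : (Fin 4 → ℝ) → (Fin 4 → ℝ) → ℝ) :
    ∑ c, ∑ d, sheetProj u e c d * B (basisV c) (basisV d)
      = ∑ c, ∑ d, sheetProj u e c d * B (basisV d) (basisV c) := by
  rw [Finset.sum_comm]
  simp only [sheetProj_comm u e]

lemma sum_sheetProj_mul_flat {u e v : Fin 4 → ℝ}
    (hv : ∀ c, v c + u c * minkEta u v - e c * minkEta e v = 0) (f : (Fin 4 → ℝ) → ℝ) :
    ∑ c, ∑ d, sheetProj u e c d * (f (basisV d) * minkEta v (basisV c)) = 0 := by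
  rw [← sum_sheetProj_swap u e fun x y => f x * minkEta v y]
  simpa only [mul_comm] using sum_sheetProj_flat_mul hv f

lemma sum_sheetProj_antisymm (u e : Fin 4 → ℝ) {B : (Fin 4 → ℝ) → (Fin 4 → ℝ) → ℝ}
    (hB : ∀ x y, B x y = -(B y x)) :
    ∑ c, ∑ d, sheetProj u e c d * B (basisV d) (basisV c) = 0 := by
  have h := sum_sheetProj_swap u e B
  have h' : ∑ c, ∑ d, sheetProj u e c d * B (basisV c) (basisV d)
      = -∑ c, ∑ d, sheetProj u e c d * B (basisV d) (basisV c) := by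
    simp only [← Finset.sum_neg_distrib, ← mul_neg, ← hB]
  linarith

lemma sum_sheetProj_minkEta (u e : Fin 4 → ℝ) :
    ∑ c, ∑ d, sheetProj u e c d * minkEta (basisV d) (basisV c)
      = 4 + minkEta u u - minkEta e e := by
  simp [Fin.sum_univ_four, sheetProj, minkM, minkEta, basisV]
  ring

/-- The `N`-trace of the bilinear form
`T = (1/√2)[ −A·u♭⊗e♭ + ((1/3)Θ+Σ)·e♭⊗e♭ + ((1/3)Θ−(1/2)Σ)·N − A·u♭⊗u♭
  + ((1/3)Θ+Σ)·e♭⊗u♭ + (1/2)φ·N + u♭⊗ω₁ + e♭⊗ω₂ + ω₃⊗(u♭+e♭) + c·ε + ζ + S ]`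
equals `(1/√2)((2/3)Θ − Σ + φ)`: the outgoing null expansion of a 2-surface whose null
normals lie in the `[u,e]` plane coincides with its LRS II value, depending only on
`Θ`, `Σ` and `φ`. -/
theorem outgoing_expansion_reduces_to_LRSII
    (u e : Fin 4 → ℝ)
    (huu : minkEta u u = -1) (hee : minkEta e e = 1) (hue : minkEta u e = 0)
    (A Θ σ φ c : ℝ)
    (Nf : (Fin 4 → ℝ) → (Fin 4 → ℝ) → ℝ)
    (hNf : ∀ x y, Nf x y = minkEta x y + minkEta u x * minkEta u y - minkEta e x * minkEta e y)
    (ω₁ ω₂ ω₃ : (Fin 4 → ℝ) →ₗ[ℝ] ℝ)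
    (hω₁ : ω₁ u = 0 ∧ ω₁ e = 0) (hω₂ : ω₂ u = 0 ∧ ω₂ e = 0) (hω₃ : ω₃ u = 0 ∧ ω₃ e = 0)
    (ε ζ S : LinearMap.BilinForm ℝ (Fin 4 → ℝ))
    (hεsheet : ∀ y, ε u y = 0 ∧ ε y u = 0 ∧ ε e y = 0 ∧ ε y e = 0)
    (hεanti : ∀ x y, ε x y = -(ε y x))
    (hζsheet : ∀ y, ζ u y = 0 ∧ ζ y u = 0 ∧ ζ e y = 0 ∧ ζ y e = 0)
    (hζsymm : ∀ x y, ζ x y = ζ y x)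
    (hζtr : Ntrace (fun a b => Nf (basisV a) (basisV b)) (fun x y => ζ x y) = 0)
    (hSsheet : ∀ y, S u y = 0 ∧ S y u = 0 ∧ S e y = 0 ∧ S y e = 0)
    (hSsymm : ∀ x y, S x y = S y x)
    (hStr : Ntrace (fun a b => Nf (basisV a) (basisV b)) (fun x y => S x y) = 0)
    (T : LinearMap.BilinForm ℝ (Fin 4 → ℝ))
    (hT : ∀ x y, T x y = (1 / Real.sqrt 2) *
      (-A * (minkEta u x * minkEta e y)
        + ((1/3) * Θ + σ) * (minkEta e x * minkEta e y)
        + ((1/3) * Θ - (1/2) * σ) * Nf x y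
        - A * (minkEta u x * minkEta u y)
        + ((1/3) * Θ + σ) * (minkEta e x * minkEta u y)
        + (1/2) * φ * Nf x y
        + minkEta u x * ω₁ y
        + minkEta e x * ω₂ y
        + ω₃ x * (minkEta u y + minkEta e y)
        + c * ε x y
        + ζ x y
        + S x y)) :
    Ntrace (fun a b => Nf (basisV a) (basisV b)) (fun x y => T x y)
      = (1 / Real.sqrt 2) * ((2/3) * Θ - σ + φ) := by
  have hu : ∀ a, u a + u a * minkEta u u - e a * minkEta e u = 0 := fun a => by
    rw [huu, minkEta_comm e u, hue]; ring
  have he : ∀ a, e a + u a * minkEta u e - e a * minkEta e e = 0 := fun a => by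
    rw [hee, hue]; ring
  rw [Ntrace_eq_sum_sheetProj hNf] at hζtr hStr ⊢
  have hη := sum_sheetProj_minkEta u e
  rw [huu, hee] at hη
  have hN : ∑ a, ∑ b, sheetProj u e a b * Nf (basisV b) (basisV a) = 2 := by
    simp only [hNf, mul_add, mul_sub, Finset.sum_add_distrib, Finset.sum_sub_distrib, hη,
      sum_sheetProj_flat_mul hu, sum_sheetProj_flat_mul he]
    norm_num
  have hε := sum_sheetProj_antisymm u e hεanti
  calc
    _ = (1 / Real.sqrt 2) *
      (-A * (∑ a, ∑ b, sheetProj u e a b * (minkEta u (basisV b) * minkEta e (basisV a)))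
        + ((1/3) * Θ + σ) *
          (∑ a, ∑ b, sheetProj u e a b * (minkEta e (basisV b) * minkEta e (basisV a)))
        + ((1/3) * Θ - (1/2) * σ + (1/2) * φ) *
          (∑ a, ∑ b, sheetProj u e a b * Nf (basisV b) (basisV a))
        - A * (∑ a, ∑ b, sheetProj u e a b * (minkEta u (basisV b) * minkEta u (basisV a)))
        + ((1/3) * Θ + σ) *
          (∑ a, ∑ b, sheetProj u e a b * (minkEta e (basisV b) * minkEta u (basisV a)))
        + (∑ a, ∑ b, sheetProj u e a b * (minkEta u (basisV b) * ω₁ (basisV a)))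
        + (∑ a, ∑ b, sheetProj u e a b * (minkEta e (basisV b) * ω₂ (basisV a)))
        + (∑ a, ∑ b, sheetProj u e a b * (ω₃ (basisV b) * minkEta u (basisV a)))
        + (∑ a, ∑ b, sheetProj u e a b * (ω₃ (basisV b) * minkEta e (basisV a)))
        + c * (∑ a, ∑ b, sheetProj u e a b * ε (basisV b) (basisV a))
        + (∑ a, ∑ b, sheetProj u e a b * ζ (basisV b) (basisV a))
        + (∑ a, ∑ b, sheetProj u e a b * S (basisV b) (basisV a))) := by
      simp only [hT, Finset.mul_sum, ← Finset.sum_add_distrib, ← Finset.sum_sub_distrib]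
      refine Finset.sum_congr rfl fun a _ => Finset.sum_congr rfl fun b _ => ?_
      ring
    _ = _ := by
      rw [hN, hε, hζtr, hStr, sum_sheetProj_flat_mul hu, sum_sheetProj_flat_mul hu,
        sum_sheetProj_flat_mul he, sum_sheetProj_flat_mul he, sum_sheetProj_mul_flat hu,
        sum_sheetProj_mul_flat he, sum_sheetProj_flat_mul hu, sum_sheetProj_flat_mul he]
      ring
end

section
/- Let T be the bilinear form T = (1/√2)·[ −A·u♭⊗e♭ + ((1/3)Θ + Σ)·e♭⊗e♭ + ((1/3)Θ − (1/2)Σ)·N + A·u♭⊗u♭ − ((1/3)Θ + Σ)·e♭⊗u♭ − (1/2)φ·N + u♭⊗ω₁ + e♭⊗ω₂ + ω₃⊗(u♭ − e♭) + c·ε + ζ + S ], where A, Θ, Σ, φ, c are real numbers, ω₁, ω₂, ω₃ are sheet covectors, ε is an antisymmetric sheet form, and ζ, S are symmetric sheet forms whose N-traces vanish. Then the N-trace N^{cd}T_{dc} (indices raised with η) equals (1/√2)·((2/3)Θ − Σ − φ). In other words, the ingoing null expansion scalar of a 2-surface in a general 4-dimensional spacetime whose null normals lie in the [u,e] plane coincides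 with its LRS II value and depends only on Θ, Σ and φ. -/
open Finset

lemma minkEta_basisV (v : Fin 4 → ℝ) (i : Fin 4) :
    minkEta v (basisV i) = minkM i i * v i := by
  fin_cases i <;> simp [minkEta, basisV, minkM]

lemma minkEta_basisV_basisV (i j : Fin 4) :
    minkEta (basisV i) (basisV j) = minkM i j := by
  fin_cases i <;> fin_cases j <;> simp [minkEta, basisV, minkM]

lemma Ntrace_add (Nm : Fin 4 → Fin 4 → ℝ) (B C : (Fin 4 → ℝ) → (Fin 4 → ℝ) → ℝ) :
    Ntrace Nm (fun x y => B x y + C x y) = Ntrace Nm B + Ntrace Nm C := by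
  simp only [Ntrace, mul_add, sum_add_distrib]

lemma Ntrace_const_mul (Nm : Fin 4 → Fin 4 → ℝ) (k : ℝ) (B : (Fin 4 → ℝ) → (Fin 4 → ℝ) → ℝ) :
    Ntrace Nm (fun x y => k * B x y) = k * Ntrace Nm B := by
  simp only [Ntrace, mul_sum, mul_left_comm k]

lemma Ntrace_swap {Nm : Fin 4 → Fin 4 → ℝ} (hNm : ∀ a b, Nm a b = Nm b a)
    (B : (Fin 4 → ℝ) → (Fin 4 → ℝ) → ℝ) :
    Ntrace Nm (fun x y => B y x) = Ntrace Nm B := by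
  unfold Ntrace
  rw [sum_comm]
  refine sum_congr rfl fun c _ => sum_congr rfl fun d _ => ?_
  congr 1
  rw [sum_comm]
  refine sum_congr rfl fun c' _ => sum_congr rfl fun d' _ => ?_
  rw [hNm d' c', mul_comm (minkM d d')]

lemma Ntrace_eq_zero_of_antisymm {Nm : Fin 4 → Fin 4 → ℝ} (hNm : ∀ a b, Nm a b = Nm b a)
    {B : (Fin 4 → ℝ) → (Fin 4 → ℝ) → ℝ} (hB : ∀ x y, B x y = -B y x) :
    Ntrace Nm B = 0 := by
  have h : Ntrace Nm (fun x y => (-1) * B y x) = Ntrace Nm B := by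
    congr 1
    funext x y
    rw [hB x y]
    ring
  rw [Ntrace_const_mul, Ntrace_swap hNm] at h
  linarith

section Projector

variable {u e : Fin 4 → ℝ} {Nf : (Fin 4 → ℝ) → (Fin 4 → ℝ) → ℝ}

lemma Ntrace_projector
    (hNf : ∀ x y, Nf x y = minkEta x y + minkEta u x * minkEta u y - minkEta e x * minkEta e y)
    (B : (Fin 4 → ℝ) → (Fin 4 → ℝ) → ℝ) :
    Ntrace (fun a b => Nf (basisV a) (basisV b)) B =
      ∑ c, ∑ d, (minkM c d + u c * u d - e c * e d) * B (basisV d) (basisV c) := by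
  unfold Ntrace
  refine sum_congr rfl fun c _ => sum_congr rfl fun d _ => ?_
  congr 1
  simp only [hNf, minkEta_basisV_basisV]
  simp only [minkEta_basisV]
  fin_cases c <;> fin_cases d <;> simp [minkM] <;> ring

lemma Ntrace_projector_left_eq_zero
    (hNf : ∀ x y, Nf x y = minkEta x y + minkEta u x * minkEta u y - minkEta e x * minkEta e y)
    {v : Fin 4 → ℝ} (hv : ∀ i, v i + minkEta u v * u i - minkEta e v * e i = 0)
    (g : (Fin 4 → ℝ) → ℝ) :
    Ntrace (fun a b => Nf (basisV a) (basisV b)) (fun x y => minkEta v x * g y) = 0 := by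
  rw [Ntrace_projector hNf]
  refine sum_eq_zero fun c _ => ?_
  have h := hv c
  simp only [minkEta] at h
  simp only [minkEta_basisV, Fin.sum_univ_four]
  fin_cases c <;> simp [minkM] at h ⊢ <;> linear_combination g (basisV _) * h

lemma Ntrace_projector_right_eq_zero
    (hNf : ∀ x y, Nf x y = minkEta x y + minkEta u x * minkEta u y - minkEta e x * minkEta e y)
    {v : Fin 4 → ℝ} (hv : ∀ i, v i + minkEta u v * u i - minkEta e v * e i = 0)
    (g : (Fin 4 → ℝ) → ℝ) :
    Ntrace (fun a b => Nf (basisV a) (basisV b)) (fun x y => g x * minkEta v y) = 0 := by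
  have hsymm : ∀ a b, Nf (basisV a) (basisV b) = Nf (basisV b) (basisV a) := fun a b => by
    rw [hNf, hNf, minkEta_comm (basisV a)]
    ring
  rw [← Ntrace_projector_left_eq_zero hNf hv g, ← Ntrace_swap hsymm]
  simp only [mul_comm]

lemma Ntrace_projector_self
    (huu : minkEta u u = -1) (hee : minkEta e e = 1)
    (hNf : ∀ x y, Nf x y = minkEta x y + minkEta u x * minkEta u y - minkEta e x * minkEta e y)
    (hu : ∀ i, u i + minkEta u u * u i - minkEta e u * e i = 0)
    (he : ∀ i, e i + minkEta u e * u i - minkEta e e * e i = 0) :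
    Ntrace (fun a b => Nf (basisV a) (basisV b)) Nf = 2 := by
  have hfun : Nf = fun x y => minkEta x y +
      (minkEta u x * minkEta u y + (-1) * (minkEta e x * minkEta e y)) := by
    funext x y
    rw [hNf]
    ring
  have htr : Ntrace (fun a b => Nf (basisV a) (basisV b)) minkEta = 2 := by
    rw [Ntrace_projector hNf]
    simp only [minkEta_basisV_basisV, Fin.sum_univ_four]
    simp only [minkEta] at huu hee
    simp [minkM]
    linear_combination huu - hee
  conv_lhs => arg 2; rw [hfun]
  rw [Ntrace_add, Ntrace_add, Ntrace_const_mul, htr,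
    Ntrace_projector_left_eq_zero hNf hu, Ntrace_projector_left_eq_zero hNf he]
  norm_num

end Projector

/-- The `N`-trace of the bilinear form
`T = (1/√2)[ −A·u♭⊗e♭ + ((1/3)Θ+Σ)·e♭⊗e♭ + ((1/3)Θ−(1/2)Σ)·N + A·u♭⊗u♭
  − ((1/3)Θ+Σ)·e♭⊗u♭ − (1/2)φ·N + u♭⊗ω₁ + e♭⊗ω₂ + ω₃⊗(u♭−e♭) + c·ε + ζ + S ]`
equals `(1/√2)((2/3)Θ − Σ − φ)`: the ingoing null expansion of a 2-surface whose null
normals lie in the `[u,e]` plane coincides with its LRS II value, depending only on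
`Θ`, `Σ` and `φ`. -/
theorem ingoing_expansion_reduces_to_LRSII
    (u e : Fin 4 → ℝ)
    (huu : minkEta u u = -1) (hee : minkEta e e = 1) (hue : minkEta u e = 0)
    (A Θ σ φ c : ℝ)
    (Nf : (Fin 4 → ℝ) → (Fin 4 → ℝ) → ℝ)
    (hNf : ∀ x y, Nf x y = minkEta x y + minkEta u x * minkEta u y - minkEta e x * minkEta e y)
    (ω₁ ω₂ ω₃ : (Fin 4 → ℝ) →ₗ[ℝ] ℝ)
    (hω₁ : ω₁ u = 0 ∧ ω₁ e = 0) (hω₂ : ω₂ u = 0 ∧ ω₂ e = 0) (hω₃ : ω₃ u = 0 ∧ ω₃ e = 0)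
    (ε ζ S : LinearMap.BilinForm ℝ (Fin 4 → ℝ))
    (hεsheet : ∀ y, ε u y = 0 ∧ ε y u = 0 ∧ ε e y = 0 ∧ ε y e = 0)
    (hεanti : ∀ x y, ε x y = -(ε y x))
    (hζsheet : ∀ y, ζ u y = 0 ∧ ζ y u = 0 ∧ ζ e y = 0 ∧ ζ y e = 0)
    (hζsymm : ∀ x y, ζ x y = ζ y x)
    (hζtr : Ntrace (fun a b => Nf (basisV a) (basisV b)) (fun x y => ζ x y) = 0)
    (hSsheet : ∀ y, S u y = 0 ∧ S y u = 0 ∧ S e y = 0 ∧ S y e = 0)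
    (hSsymm : ∀ x y, S x y = S y x)
    (hStr : Ntrace (fun a b => Nf (basisV a) (basisV b)) (fun x y => S x y) = 0)
    (T : LinearMap.BilinForm ℝ (Fin 4 → ℝ))
    (hT : ∀ x y, T x y = (1 / Real.sqrt 2) *
      (-A * (minkEta u x * minkEta e y)
        + ((1/3) * Θ + σ) * (minkEta e x * minkEta e y)
        + ((1/3) * Θ - (1/2) * σ) * Nf x y
        + A * (minkEta u x * minkEta u y)
        - ((1/3) * Θ + σ) * (minkEta e x * minkEta u y)
        - (1/2) * φ * Nf x y
        + minkEta u x * ω₁ y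
        + minkEta e x * ω₂ y
        + ω₃ x * (minkEta u y - minkEta e y)
        + c * ε x y
        + ζ x y
        + S x y)) :
    Ntrace (fun a b => Nf (basisV a) (basisV b)) (fun x y => T x y)
      = (1 / Real.sqrt 2) * ((2/3) * Θ - σ - φ) := by
  have heu : minkEta e u = 0 := by rw [minkEta_comm, hue]
  have hu : ∀ i, u i + minkEta u u * u i - minkEta e u * e i = 0 := fun i => by
    rw [huu, heu]; ring
  have he : ∀ i, e i + minkEta u e * u i - minkEta e e * e i = 0 := fun i => by
    rw [hue, hee]; ring
  have hsymm : ∀ a b, Nf (basisV a) (basisV b) = Nf (basisV b) (basisV a) := fun a b => by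
    rw [hNf, hNf, minkEta_comm (basisV a)]
    ring
  have hfun : (fun x y => T x y) = fun x y => (1 / Real.sqrt 2) *
      (minkEta u x * (-A * minkEta e y + A * minkEta u y + ω₁ y)
        + (minkEta e x * (((1/3) * Θ + σ) * (minkEta e y - minkEta u y) + ω₂ y)
        + (ω₃ x * minkEta u y
        + ((-ω₃ x) * minkEta e y
        + (((1/3) * Θ - (1/2) * σ - (1/2) * φ) * Nf x y
        + (c * ε x y + (ζ x y + S x y))))))) := by
    funext x y
    rw [hT]
    ring
  rw [hfun]
  simp only [Ntrace_const_mul, Ntrace_add]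
  rw [Ntrace_projector_left_eq_zero hNf hu, Ntrace_projector_left_eq_zero hNf he,
    Ntrace_projector_right_eq_zero hNf hu, Ntrace_projector_right_eq_zero hNf he,
    Ntrace_projector_self huu hee hNf hu he,
    Ntrace_eq_zero_of_antisymm hsymm hεanti, hζtr, hStr]
  ring
end
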